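/- arXiv:2304.12070 — 2 statements merged into one kernel-verified Lean document; each statement's English description precedes it below -/
import Mathlib

section
/- Let I(x,y) be a symmetric positive real function with property P*, and let TI be the associated VDB topological index. Let k ≥ 1 and let G be a graph achieving the least value of TI over 𝒢_{n,k}, the set of connected k-cyclic graphs with n vertices. Then δ(G) ≥ 2. -/
attribute [local instance] Classical.propDecidable

/-- The vertex-degree-based topological index `TI(G) = Σ_{uv ∈ E(G)} I(d_u, d_v)`
(the summand is symmetrized, which agrees with `I(d_u,d_v)` when `I` is symmetric). -/
noncomputable def vdbTI {V : Type*} [Fintype V] (I : ℝ → ℝ → ℝ) (G : SimpleGraph V) : ℝ :=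
  ∑ e ∈ G.edgeFinset, Sym2.lift
    ⟨fun u v => (I (G.degree u) (G.degree v) + I (G.degree v) (G.degree u)) / 2,
     fun _ _ => by ring⟩ e

/-- Property P: `I(x,y)` is monotonically increasing in `x` and, for any `a ≥ b ≥ 0`,
`h(x) = I(a,x) - I(b,x)` is monotonically decreasing in `x`. -/
def PropertyP (I : ℝ → ℝ → ℝ) : Prop :=
  (∀ y : ℝ, 1 ≤ y → MonotoneOn (fun x => I x y) (Set.Ici 1)) ∧
  (∀ a b : ℝ, 0 ≤ b → b ≤ a → AntitoneOn (fun x => I a x - I b x) (Set.Ici 1))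

/-- Property P*: property P together with `H(a,b) > 0` for all integers `a > b + 1 ≥ 2`,
where `H(a,b) = a[I(a,a) - I(a-1,a)] - b[I(b+1,b) - I(b,b)]`. -/
def PropertyPStar (I : ℝ → ℝ → ℝ) : Prop :=
  PropertyP I ∧
  ∀ a b : ℕ, 2 ≤ b + 1 → b + 1 < a →
    0 < (a : ℝ) * (I a a - I ((a : ℝ) - 1) a) - (b : ℝ) * (I ((b : ℝ) + 1) b - I b b)

namespace SimpleGraph

variable {V : Type*}

/-- The graph obtained from `G` by replacing the edge `xw` with the edge `uw`. -/
def moveEdge (G : SimpleGraph V) (x u w : V) : SimpleGraph V :=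
  G.deleteEdges {s(x, w)} ⊔ edge u w

lemma moveEdge_connected {G : SimpleGraph V} {x u w : V} (hG : G.Connected) (huw : u ≠ w)
    (h : (G.deleteEdges {s(x, w)}).Reachable x u) : (G.moveEdge x u w).Connected := by
  have hadj : (G.moveEdge x u w).Adj u w :=
    Or.inr ((edge_adj ..).2 ⟨Or.inl ⟨rfl, rfl⟩, huw⟩)
  have hxw : (G.moveEdge x u w).Reachable x w :=
    (h.mono le_sup_left).trans hadj.reachable
  have hstep : ∀ y z, G.Adj y z → (G.moveEdge x u w).Reachable y z := by
    intro y z hyz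
    by_cases he : s(y, z) = s(x, w)
    · rcases Sym2.eq_iff.1 he with ⟨rfl, rfl⟩ | ⟨rfl, rfl⟩
      exacts [hxw, hxw.symm]
    · exact Adj.reachable (Or.inl ((deleteEdges_adj ..).2 ⟨hyz, he⟩))
  have := hG.nonempty
  refine ⟨fun y z => ?_⟩
  obtain ⟨p⟩ := hG y z
  induction p with
  | nil => rfl
  | cons h _ ih => exact (hstep _ _ h).trans ih

variable [Fintype V]

lemma sum_edgeFinset_ite_mem (G : SimpleGraph V) (v : V) (c : ℝ) :
    ∑ e ∈ G.edgeFinset, (if v ∈ e then c else 0) = G.degree v * c := by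
  rw [← Finset.sum_filter, Finset.sum_const, nsmul_eq_mul, ← incidenceFinset_eq_filter,
    card_incidenceFinset_eq_degree]

lemma edgeFinset_moveEdge (G : SimpleGraph V) {x u w : V} (huw : u ≠ w) :
    (G.moveEdge x u w).edgeFinset = insert s(u, w) (G.edgeFinset.erase s(x, w)) := by
  ext e
  rw [mem_edgeFinset, moveEdge, edgeSet_sup, edgeSet_deleteEdges, edgeSet_edge_of_ne huw]
  simp only [mem_edgeFinset, Finset.mem_insert, Finset.mem_erase, Set.mem_union, Set.mem_sdiff,
    Set.mem_singleton_iff]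
  tauto

lemma sum_edgeFinset_moveEdge {M : Type*} [AddCommGroup M] (G : SimpleGraph V) {x u w : V}
    (huw : u ≠ w) (hnuw : ¬ G.Adj u w) (hxw : G.Adj x w) (f : Sym2 V → M) :
    ∑ e ∈ (G.moveEdge x u w).edgeFinset, f e =
      ∑ e ∈ G.edgeFinset, f e - f s(x, w) + f s(u, w) := by
  rw [edgeFinset_moveEdge G huw, Finset.sum_insert (by simp [hnuw]),
    ← Finset.add_sum_erase _ f (mem_edgeFinset.2 hxw : s(x, w) ∈ G.edgeFinset)]
  abel

lemma card_edgeFinset_moveEdge (G : SimpleGraph V) {x u w : V}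
    (huw : u ≠ w) (hnuw : ¬ G.Adj u w) (hxw : G.Adj x w) :
    (G.moveEdge x u w).edgeFinset.card = G.edgeFinset.card := by
  have := sum_edgeFinset_moveEdge G huw hnuw hxw (fun _ => (1 : ℤ))
  simp only [Finset.sum_const, nsmul_eq_mul, mul_one] at this
  omega

lemma degree_moveEdge (G : SimpleGraph V) {x u w : V}
    (huw : u ≠ w) (hnuw : ¬ G.Adj u w) (hxw : G.Adj x w) (v : V) :
    ((G.moveEdge x u w).degree v : ℝ) =
      G.degree v - (if v ∈ s(x, w) then 1 else 0) + (if v ∈ s(u, w) then 1 else 0) := by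
  have := sum_edgeFinset_moveEdge G huw hnuw hxw (fun e => if v ∈ e then (1 : ℝ) else 0)
  rwa [sum_edgeFinset_ite_mem, sum_edgeFinset_ite_mem, mul_one, mul_one] at this

/-- Moving an edge from a vertex of maximum degree to a vertex of minimum degree lowers `TI`. -/
lemma vdbTI_moveEdge_lt {I : ℝ → ℝ → ℝ}
    (hsym : ∀ x y : ℝ, 1 ≤ x → 1 ≤ y → I x y = I y x) (hP : PropertyPStar I)
    (G : SimpleGraph V) {x u w : V} (huw : u ≠ w) (hnuw : ¬ G.Adj u w) (hxw : G.Adj x w)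
    (hmax : ∀ v, G.degree v ≤ G.degree x) (hmin : ∀ v, G.degree u ≤ G.degree v)
    (hu : 1 ≤ G.degree u) (hux : G.degree u + 1 < G.degree x) :
    vdbTI I (G.moveEdge x u w) < vdbTI I G := by
  obtain ⟨⟨hmono, hanti⟩, hH⟩ := hP
  have hne : x ≠ u := by rintro rfl; omega
  have hH := hH _ _ (by omega) hux
  set d : V → ℝ := fun v => (G.degree v : ℝ) with hd
  set d' : V → ℝ := fun v => ((G.moveEdge x u w).degree v : ℝ) with hd'
  set a : ℝ := (G.degree x : ℝ) with ha
  set b : ℝ := (G.degree u : ℝ) with hb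
  have hda : ∀ v, d v ≤ a := fun v => by simpa [hd, ha] using hmax v
  have hdb : ∀ v, b ≤ d v := fun v => by simpa [hd, hb] using hmin v
  have hb1 : 1 ≤ b := by rw [hb]; exact_mod_cast hu
  have hab : b + 2 ≤ a := by rw [ha, hb]; exact_mod_cast hux
  have hd'x : d' x = a - 1 := by
    simp [hd', degree_moveEdge G huw hnuw hxw, ha, hne, hxw.ne]
  have hd'u : d' u = b + 1 := by
    simp [hd', degree_moveEdge G huw hnuw hxw, hb, hne.symm, huw]
  have hd'v : ∀ v, v ≠ x → v ≠ u → d' v = d v := by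
    intro v h1 h2
    simp [hd', hd, degree_moveEdge G huw hnuw hxw, h1, h2]
  have hloss : ∀ t, 1 ≤ t → t ≤ a → I a a - I (a - 1) a ≤ I a t - I (a - 1) t :=
    fun t h1 h2 => hanti a (a - 1) (by linarith) (by linarith) (Set.mem_Ici.2 h1)
      (Set.mem_Ici.2 (by linarith)) h2
  have hgain : ∀ t, b ≤ t → I (b + 1) t - I b t ≤ I (b + 1) b - I b b :=
    fun t h => hanti (b + 1) b (by linarith) (by linarith) (Set.mem_Ici.2 hb1)
      (Set.mem_Ici.2 (by linarith)) h
  set A := I a a - I (a - 1) a with hA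
  set B := I (b + 1) b - I b b with hB
  have hd1 : ∀ v, 1 ≤ d v := fun v => hb1.trans (hdb v)
  have hd1' : ∀ v, 1 ≤ d' v := by
    intro v
    by_cases h1 : v = x
    · subst h1; linarith
    by_cases h2 : v = u
    · subst h2; linarith
    rw [hd'v v h1 h2]; exact hd1 v
  have hedge : ∀ y z, G.Adj y z →
      (if x ∈ s(y, z) then A else 0) - (if u ∈ s(y, z) then B else 0) ≤
        I (d y) (d z) - I (d' y) (d' z) := by
    have hx : ∀ z, z ≠ x → (if x ∈ s(x, z) then A else 0) - (if u ∈ s(x, z) then B else 0) ≤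
        I (d x) (d z) - I (d' x) (d' z) := by
      intro z hz
      have hdx : d x = a := rfl
      by_cases hzu : z = u
      · subst hzu
        have hdz : d z = b := rfl
        have h1 := hloss b hb1 (by linarith)
        have h2 := hgain (a - 1) (by linarith)
        rw [hsym _ (a - 1) (by linarith) (by linarith), hsym b (a - 1) hb1 (by linarith)] at h2
        simp only [Sym2.mem_iff, true_or, or_true, if_true, hd'x, hd'u, hdx, hdz]
        linarith
      · have h1 := hloss (d z) (hb1.trans (hdb z)) (hda z)
        simp only [Sym2.mem_iff, true_or, if_true, hne.symm, Ne.symm hzu, or_self, if_false,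
          hd'x, hd'v z hz hzu, hdx]
        linarith
    have hu : ∀ z, z ≠ x → z ≠ u →
        (if x ∈ s(u, z) then A else 0) - (if u ∈ s(u, z) then B else 0) ≤
        I (d u) (d z) - I (d' u) (d' z) := by
      intro z hzx hzu
      have hdu : d u = b := rfl
      have h1 := hgain (d z) (hdb z)
      simp only [Sym2.mem_iff, true_or, if_true, hne, Ne.symm hzx, or_self, if_false,
        hd'u, hd'v z hzx hzu, hdu]
      linarith
    intro y z hyz
    by_cases hyx : y = x
    · subst hyx; exact hx z hyz.ne'
    by_cases hzx : z = x
    · subst hzx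
      rw [Sym2.eq_swap, hsym _ _ (hd1 y) (hd1 z), hsym _ _ (hd1' y) (hd1' z)]
      exact hx y hyx
    by_cases hyu : y = u
    · subst hyu; exact hu z hzx hyz.ne'
    by_cases hzu : z = u
    · subst hzu
      rw [Sym2.eq_swap, hsym _ _ (hd1 y) (hd1 z), hsym _ _ (hd1' y) (hd1' z)]
      exact hu y hyx hyu
    simp [hd'v y hyx hyu, hd'v z hzx hzu, Ne.symm hyx, Ne.symm hzx, Ne.symm hyu, Ne.symm hzu]
  have hlift : ∀ δ : V → ℝ, (∀ v, 1 ≤ δ v) → ∀ y z,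
      (I (δ y) (δ z) + I (δ z) (δ y)) / 2 = I (δ y) (δ z) := by
    intro δ hδ y z
    rw [hsym _ _ (hδ z) (hδ y)]; ring
  have hdw : d' w = d w := hd'v w hxw.ne' huw.symm
  have hmove : I (b + 1) (d w) ≤ I (a - 1) (d w) :=
    hmono _ (hd1 w) (Set.mem_Ici.2 (by linarith)) (Set.mem_Ici.2 (by linarith)) (by linarith)
  have hsum : ∑ e ∈ G.edgeFinset, ((if x ∈ e then A else 0) - (if u ∈ e then B else 0)) ≤
      ∑ e ∈ G.edgeFinset, (Sym2.lift
          ⟨fun u v => (I (d u) (d v) + I (d v) (d u)) / 2, fun _ _ => by ring⟩ e -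
        Sym2.lift
          ⟨fun u v => (I (d' u) (d' v) + I (d' v) (d' u)) / 2, fun _ _ => by ring⟩ e) := by
    refine Finset.sum_le_sum fun e he => ?_
    induction e with | _ y z
    rw [Sym2.lift_mk, Sym2.lift_mk]
    dsimp only
    rw [hlift d hd1, hlift d' hd1']
    exact hedge y z (mem_edgeFinset.1 he)
  rw [Finset.sum_sub_distrib, Finset.sum_sub_distrib, sum_edgeFinset_ite_mem,
    sum_edgeFinset_ite_mem] at hsum
  rw [vdbTI, sum_edgeFinset_moveEdge G huw hnuw hxw, Sym2.lift_mk, Sym2.lift_mk, vdbTI]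
  have h1 : (I (d' x) (d' w) + I (d' w) (d' x)) / 2 = I (a - 1) (d w) := by
    rw [hlift d' hd1', hd'x, hdw]
  have h2 : (I (d' u) (d' w) + I (d' w) (d' u)) / 2 = I (b + 1) (d w) := by
    rw [hlift d' hd1', hd'u, hdw]
  dsimp only
  rw [h1, h2]
  linarith

end SimpleGraph

/-- A connected graph with at least as many edges as vertices has a vertex of degree at least `3`
as soon as it has one of degree less than `2`. -/
lemma SimpleGraph.exists_three_le_degree {V : Type*} [Fintype V] {G : SimpleGraph V}
    (hm : Fintype.card V ≤ G.edgeFinset.card) {u : V} (hu : G.degree u < 2) :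
    ∃ x, 3 ≤ G.degree x := by
  by_contra! h
  have hlt : ∑ v, G.degree v < ∑ _v : V, 2 :=
    Finset.sum_lt_sum (fun v _ => Nat.le_of_lt_succ (h v)) ⟨u, Finset.mem_univ u, hu⟩
  rw [G.sum_degrees_eq_twice_card_edges, Finset.sum_const, Finset.card_univ, smul_eq_mul] at hlt
  omega

/-- If `u` is a leaf and `x` has degree at least `3`, some edge at `x` can be moved to `u` without
disconnecting the graph. -/
lemma SimpleGraph.exists_moveEdge_connected {V : Type*} [Fintype V] {G : SimpleGraph V}
    (hG : G.Connected) {x u : V} (hu : G.degree u = 1) (hx : 3 ≤ G.degree x) :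
    ∃ w, u ≠ w ∧ ¬ G.Adj u w ∧ G.Adj x w ∧ (G.moveEdge x u w).Connected := by
  obtain ⟨v, hv⟩ := Finset.card_eq_one.1 hu
  have huv : ∀ z, G.Adj u z ↔ z = v := fun z => by
    rw [← mem_neighborFinset, hv, Finset.mem_singleton]
  obtain ⟨p, hp⟩ := hG.exists_isPath x u
  obtain ⟨w, hw, hw'⟩ := Finset.exists_mem_notMem_of_card_lt_card
    (s := {p.snd, if x = v then u else v}) (t := G.neighborFinset x)
    (lt_of_le_of_lt Finset.card_le_two (by rw [card_neighborFinset_eq_degree]; omega))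
  rw [mem_neighborFinset] at hw
  simp only [Finset.mem_insert, Finset.mem_singleton, not_or] at hw'
  obtain ⟨hws, hwv⟩ := hw'
  have huw : u ≠ w := by
    rintro rfl
    have : x = v := (huv x).1 hw.symm
    simp [this] at hwv
  refine ⟨w, huw, fun h => ?_, hw, moveEdge_connected hG huw ?_⟩
  · obtain rfl := (huv w).1 h
    simp [hw.ne] at hwv
  · exact ⟨p.toDeleteEdge _ fun h => hws (hp.eq_snd_of_mem_edges h)⟩

theorem minimal_vdb_kcyclic_minDegree (n k : ℕ) (hk : 1 ≤ k) (I : ℝ → ℝ → ℝ)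
    (hsym : ∀ x y : ℝ, 1 ≤ x → 1 ≤ y → I x y = I y x)
    (hpos : ∀ x y : ℝ, 1 ≤ x → 1 ≤ y → 0 < I x y)
    (hP : PropertyPStar I)
    (G : SimpleGraph (Fin n)) (hconn : G.Connected) (hm : G.edgeFinset.card = n + k - 1)
    (hmin : ∀ H : SimpleGraph (Fin n), H.Connected → H.edgeFinset.card = n + k - 1 →
      vdbTI I G ≤ vdbTI I H) :
    2 ≤ G.minDegree := by
  have := hconn.nonempty
  refine G.le_minDegree_of_forall_le_degree 2 fun u => ?_
  by_contra! hu
  obtain ⟨y, hy⟩ := SimpleGraph.exists_three_le_degree (G := G)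
    (by rw [Fintype.card_fin]; omega) hu
  obtain ⟨x, hx⟩ := G.exists_maximal_degree_vertex
  have hmax : ∀ v, G.degree v ≤ G.degree x := fun v => hx ▸ G.degree_le_maxDegree v
  have hx3 : 3 ≤ G.degree x := hy.trans (hmax y)
  have : Nontrivial (Fin n) := ⟨x, u, by rintro rfl; omega⟩
  have hpos_deg : ∀ v, 1 ≤ G.degree v := fun v => hconn.preconnected.degree_pos_of_nontrivial v
  have hu1 : G.degree u = 1 := by have := hpos_deg u; omega
  obtain ⟨w, huw, hnuw, hxw, hcon⟩ := SimpleGraph.exists_moveEdge_connected hconn hu1 hx3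
  exact (G.vdbTI_moveEdge_lt hsym hP huw hnuw hxw hmax (fun v => hu1 ▸ hpos_deg v) hu1.ge
    (by omega)).not_ge
    (hmin _ hcon ((G.card_edgeFinset_moveEdge huw hnuw hxw).trans hm))
end

section
/- Let p ∈ (1, 2], k ≥ 3 and n ≥ 5(k−1). If G is a graph achieving the least value of the p-Sombor index S_p over 𝒢_{n,k}, then G is a bidegreed graph with degree set {2,3}, m_{2,3}(G) = 2, m_{2,2}(G) = n − 2k + 1, m_{3,3}(G) = 3k − 4, and S_p(G) = 2·(2^p + 3^p)^{1/p} + (n − 2k + 1)·(2^p + 2^p)^{1/p} + (3k − 4)·(3^p + 3^p)^{1/p}. -/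
attribute [local instance] Classical.propDecidable

/-- `mDeg G i j` is the number of edges of `G` joining a vertex of degree `i`
with a vertex of degree `j`. -/
noncomputable def mDeg {V : Type*} [Fintype V] (G : SimpleGraph V) (i j : ℕ) : ℕ :=
  (G.edgeFinset.filter (fun e => Sym2.lift
    ⟨fun u v => (G.degree u = i ∧ G.degree v = j) ∨ (G.degree v = i ∧ G.degree u = j),
     fun _ _ => propext or_comm⟩ e)).card

/-- The p-Sombor index `S_p(G) = Σ_{uv ∈ E(G)} (d_u^p + d_v^p)^{1/p}`. -/
noncomputable def pSomborIndex {V : Type*} [Fintype V] (p : ℝ) (G : SimpleGraph V) : ℝ :=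
  vdbTI (fun x y => (x ^ p + y ^ p) ^ (1 / p)) G

/-- Summing `g u + g v` over the edges `uv` counts `g v` once for every edge at `v`. -/
theorem sum_edgeFinset_add {V M : Type*} [Fintype V] [AddCommMonoid M] (G : SimpleGraph V)
    (g : V → M) :
    ∑ e ∈ G.edgeFinset, Sym2.lift ⟨fun u v => g u + g v, fun _ _ => add_comm _ _⟩ e
      = ∑ v, G.degree v • g v := by
  have h : ∀ e ∈ G.edgeFinset,
      Sym2.lift ⟨fun u v => g u + g v, fun _ _ => add_comm _ _⟩ e
        = ∑ w, if w ∈ e then g w else 0 := by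
    intro e
    induction e using Sym2.ind with
    | _ u v =>
      intro he
      have huv : u ≠ v := (SimpleGraph.mem_edgeSet _ |>.1 (SimpleGraph.mem_edgeFinset.1 he)).ne
      rw [← Finset.sum_filter]
      have : (Finset.univ.filter fun w => w ∈ s(u, v)) = {u, v} := by
        ext w; simp
      rw [this, Finset.sum_pair huv]
      rfl
  rw [Finset.sum_congr rfl h, Finset.sum_comm]
  refine Finset.sum_congr rfl fun v _ => ?_
  rw [← Finset.sum_filter, Finset.sum_const, ← SimpleGraph.card_incidenceFinset_eq_degree,
    SimpleGraph.incidenceFinset_eq_filter]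

section PowerMean

variable {p : ℝ}

theorem pNorm_diag (hp : 1 < p) {a : ℝ} (ha : 0 ≤ a) :
    (a ^ p + a ^ p) ^ (1 / p) = 2 ^ (1 / p) * a := by
  rw [← two_mul, Real.mul_rpow (by norm_num) (by positivity), ← Real.rpow_mul ha,
    mul_one_div_cancel (by linarith), Real.rpow_one]

theorem lt_pNorm (hp : 1 < p) {a b : ℝ} (ha : 0 ≤ a) (hb : 0 ≤ b) (hab : a ≠ b) :
    2 ^ (1 / p) * ((a + b) / 2) < (a ^ p + b ^ p) ^ (1 / p) := by
  rw [← pNorm_diag hp (by positivity)]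
  refine Real.rpow_lt_rpow (by positivity) ?_ (by positivity)
  have h := (strictConvexOn_rpow hp).2 ha hb hab
    (by norm_num : (0 : ℝ) < 1 / 2) (by norm_num : (0 : ℝ) < 1 / 2) (by norm_num)
  simp only [smul_eq_mul] at h
  rw [show (a + b) / 2 = 1 / 2 * a + 1 / 2 * b by ring]
  linarith

theorem le_pNorm (hp : 1 < p) {a b : ℝ} (ha : 0 ≤ a) (hb : 0 ≤ b) :
    2 ^ (1 / p) * ((a + b) / 2) ≤ (a ^ p + b ^ p) ^ (1 / p) := by
  rcases eq_or_ne a b with rfl | hab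
  · rw [pNorm_diag hp ha, add_self_div_two]
  · exact (lt_pNorm hp ha hb hab).le

theorem pNorm_two_three_lt (hp : 1 < p) :
    ((2 : ℝ) ^ p + 3 ^ p) ^ (1 / p) < 2 ^ (1 / p) * 3 := by
  rw [← pNorm_diag hp (by norm_num)]
  have : (2 : ℝ) ^ p < 3 ^ p := Real.rpow_lt_rpow (by norm_num) (by norm_num) (by linarith)
  exact Real.rpow_lt_rpow (by positivity) (by linarith) (by positivity)

end PowerMean

section Degrees

variable {V : Type*} [Fintype V] (G : SimpleGraph V)

theorem sum_edgeFinset_degree_add :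
    ∑ e ∈ G.edgeFinset, Sym2.lift
      ⟨fun u v => (G.degree u : ℝ) + G.degree v, fun _ _ => add_comm _ _⟩ e
      = ∑ v, (G.degree v : ℝ) ^ 2 := by
  rw [sum_edgeFinset_add G fun v => (G.degree v : ℝ)]
  simp [sq]

theorem le_pSomborIndex {p : ℝ} (hp : 1 < p) :
    2 ^ (1 / p) / 2 * ∑ v, (G.degree v : ℝ) ^ 2 ≤ pSomborIndex p G := by
  rw [← sum_edgeFinset_degree_add, Finset.mul_sum, pSomborIndex, vdbTI]
  refine Finset.sum_le_sum fun e _ => ?_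
  induction e using Sym2.ind with
  | _ u v =>
    have h := le_pNorm hp (Nat.cast_nonneg (G.degree u)) (Nat.cast_nonneg (G.degree v))
    simp only [Sym2.lift_mk]
    rw [add_comm ((G.degree v : ℝ) ^ p)]
    linarith

variable {G}

theorem pSomborIndex_of_bidegreed {p : ℝ} (hp : 1 < p)
    (h : ∀ v, G.degree v = 2 ∨ G.degree v = 3) :
    pSomborIndex p G = 2 ^ (1 / p) / 2 * ∑ v, (G.degree v : ℝ) ^ 2
      + mDeg G 2 3 * (((2 : ℝ) ^ p + 3 ^ p) ^ (1 / p) - 2 ^ (1 / p) * (5 / 2)) := by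
  rw [← sum_edgeFinset_degree_add, Finset.mul_sum, pSomborIndex, vdbTI, mDeg,
    Finset.card_filter, Nat.cast_sum, Finset.sum_mul, ← Finset.sum_add_distrib]
  refine Finset.sum_congr rfl fun e _ => ?_
  induction e using Sym2.ind with
  | _ u v =>
    have h2 := pNorm_diag hp (a := 2) (by norm_num)
    have h3 := pNorm_diag hp (a := 3) (by norm_num)
    have hc := add_comm ((3 : ℝ) ^ p) (2 ^ p)
    simp only [Sym2.lift_mk]
    rcases h u with hu | hu <;> rcases h v with hv | hv <;> simp only [hu, hv] <;>
      norm_num only [Nat.cast_ofNat, h2, h3, hc] <;> simp <;> ring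

theorem two_mul_card_degree_two (h : ∀ v, G.degree v = 2 ∨ G.degree v = 3) :
    2 * (Finset.univ.filter fun v => G.degree v = 2).card = 2 * mDeg G 2 2 + mDeg G 2 3 := by
  have key := sum_edgeFinset_add G fun v => if G.degree v = 2 then 1 else 0
  rw [Finset.card_filter, mDeg, mDeg, Finset.card_filter, Finset.card_filter, Finset.mul_sum,
    Finset.mul_sum, ← Finset.sum_add_distrib]
  refine Eq.trans (Finset.sum_congr rfl fun v _ => ?_)
    (key.symm.trans (Finset.sum_congr rfl fun e _ => ?_))
  · rcases h v with hv | hv <;> simp [hv]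
  · induction e using Sym2.ind with
    | _ u v =>
      simp only [Sym2.lift_mk]
      rcases h u with hu | hu <;> rcases h v with hv | hv <;> simp [hu, hv]

theorem three_mul_card_degree_three (h : ∀ v, G.degree v = 2 ∨ G.degree v = 3) :
    3 * (Finset.univ.filter fun v => G.degree v = 3).card = 2 * mDeg G 3 3 + mDeg G 2 3 := by
  have key := sum_edgeFinset_add G fun v => if G.degree v = 3 then 1 else 0
  rw [Finset.card_filter, mDeg, mDeg, Finset.card_filter, Finset.card_filter, Finset.mul_sum,
    Finset.mul_sum, ← Finset.sum_add_distrib]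
  refine Eq.trans (Finset.sum_congr rfl fun v _ => ?_)
    (key.symm.trans (Finset.sum_congr rfl fun e _ => ?_))
  · rcases h v with hv | hv <;> simp [hv]
  · induction e using Sym2.ind with
    | _ u v =>
      simp only [Sym2.lift_mk]
      rcases h u with hu | hu <;> rcases h v with hv | hv <;> simp [hu, hv]

theorem mDeg_two_three_pos (hG : G.Connected) (h : ∀ v, G.degree v = 2 ∨ G.degree v = 3)
    (h2 : ∃ v, G.degree v = 2) (h3 : ∃ v, G.degree v = 3) : 0 < mDeg G 2 3 := by
  obtain ⟨u, hu⟩ := h2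
  obtain ⟨v, hv⟩ := h3
  obtain ⟨w⟩ := hG.preconnected u v
  obtain ⟨d, -, hd1, hd2⟩ := w.exists_boundary_dart {x | G.degree x = 2} hu (by simp [hv])
  rw [mDeg, Finset.card_pos]
  refine ⟨s(d.fst, d.snd), Finset.mem_filter.2 ⟨SimpleGraph.mem_edgeFinset.2 d.adj, ?_⟩⟩
  exact Or.inl ⟨hd1, (h _).resolve_left hd2⟩

/-- For a given order and size, the sum of the squared degrees is determined by
`Σ (d - 2) (d - 3)`. -/
theorem sum_degree_sq (G : SimpleGraph V) :
    ∑ v, (G.degree v : ℝ) ^ 2 = 10 * G.edgeFinset.card - 6 * Fintype.card V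
      + ∑ v, ((G.degree v : ℝ) - 2) * (G.degree v - 3) := by
  have h : (∑ v, (G.degree v : ℝ)) = 2 * G.edgeFinset.card := by
    exact_mod_cast G.sum_degrees_eq_twice_card_edges
  have : ∑ v, ((G.degree v : ℝ) - 2) * (G.degree v - 3)
      = ∑ v, ((G.degree v : ℝ) ^ 2 - 5 * G.degree v + 6) :=
    Finset.sum_congr rfl fun v _ => by ring
  rw [this, Finset.sum_add_distrib, Finset.sum_sub_distrib, ← Finset.mul_sum, h]
  simp
  ring

theorem natCast_sub_two_mul_sub_three_nonneg (d : ℕ) : 0 ≤ ((d : ℝ) - 2) * (d - 3) := by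
  rcases Nat.lt_or_ge d 3 with hd | hd
  · have : (d : ℝ) ≤ 2 := by exact_mod_cast Nat.le_of_lt_succ hd
    nlinarith
  · have : (3 : ℝ) ≤ d := by exact_mod_cast hd
    nlinarith

theorem two_le_natCast_sub_two_mul_sub_three {d : ℕ} (h2 : d ≠ 2) (h3 : d ≠ 3) :
    2 ≤ ((d : ℝ) - 2) * (d - 3) := by
  rcases Nat.lt_or_ge d 2 with hd | hd
  · have : (d : ℝ) ≤ 1 := by exact_mod_cast Nat.le_of_lt_succ hd
    nlinarith
  · have : (4 : ℝ) ≤ d := by exact_mod_cast (by omega : 4 ≤ d)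
    nlinarith

theorem sum_degree_sq_of_bidegreed (h : ∀ v, G.degree v = 2 ∨ G.degree v = 3) :
    ∑ v, (G.degree v : ℝ) ^ 2 = 10 * G.edgeFinset.card - 6 * Fintype.card V := by
  rw [sum_degree_sq, Finset.sum_eq_zero, add_zero]
  intro v _
  rcases h v with hv | hv <;> simp [hv]

theorem le_sum_degree_sq_of_not_bidegreed (h : ¬ ∀ v, G.degree v = 2 ∨ G.degree v = 3) :
    10 * G.edgeFinset.card - 6 * Fintype.card V + 2 ≤ ∑ v, (G.degree v : ℝ) ^ 2 := by
  push Not at h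
  obtain ⟨v, h2, h3⟩ := h
  rw [sum_degree_sq]
  have := Finset.single_le_sum (f := fun v => ((G.degree v : ℝ) - 2) * (G.degree v - 3))
    (fun v _ => natCast_sub_two_mul_sub_three_nonneg _) (Finset.mem_univ v)
  have := two_le_natCast_sub_two_mul_sub_three h2 h3
  linarith

end Degrees

/-- The cycle on `n` vertices together with the chords joining `i` and `i + j` for `i < j`. -/
def chordedCycle (n j : ℕ) : SimpleGraph (Fin n) :=
  SimpleGraph.fromRel fun u v =>
    u.val + 1 = v.val ∨ (u.val + 1 = n ∧ v.val = 0) ∨ (u.val + j = v.val ∧ u.val < j)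

section ChordedCycle

variable {n j : ℕ}

theorem chordedCycle_adj {u v : Fin n} : (chordedCycle n j).Adj u v ↔ u.val ≠ v.val ∧
    ((u.val + 1 = v.val ∨ (u.val + 1 = n ∧ v.val = 0) ∨ (u.val + j = v.val ∧ u.val < j)) ∨
      (v.val + 1 = u.val ∨ (v.val + 1 = n ∧ u.val = 0) ∨ (v.val + j = u.val ∧ v.val < j))) := by
  rw [chordedCycle, SimpleGraph.fromRel_adj, Ne, Fin.ext_iff]

theorem chordedCycle_connected (hn : 0 < n) : (chordedCycle n j).Connected := by
  have h : ∀ i (hi : i < n), (chordedCycle n j).Reachable ⟨0, hn⟩ ⟨i, hi⟩ := by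
    intro i
    induction i with
    | zero => exact fun _ => .refl _
    | succ i ih =>
      intro hi
      refine (ih (by omega)).trans (SimpleGraph.Adj.reachable ?_)
      rw [chordedCycle_adj]
      simp
  have : Nonempty (Fin n) := ⟨⟨0, hn⟩⟩
  exact ⟨fun u v => (h u u.2).symm.trans (h v v.2)⟩

theorem chordedCycle_degree_of_lt (hj : 2 ≤ j) (hn : 2 * j < n) {v : Fin n} (hv : v.val < 2 * j) :
    (chordedCycle n j).degree v = 3 := by
  rw [← SimpleGraph.card_neighborFinset_eq_degree, Finset.card_eq_three]
  refine ⟨⟨v.val + 1, by omega⟩, ⟨if v.val = 0 then n - 1 else v.val - 1, by split_ifs <;> omega⟩,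
    ⟨if v.val < j then v.val + j else v.val - j, by split_ifs <;> omega⟩, ?_, ?_, ?_, ?_⟩
  · simp only [Ne, Fin.ext_iff]; split_ifs <;> omega
  · simp only [Ne, Fin.ext_iff]; split_ifs <;> omega
  · simp only [Ne, Fin.ext_iff]; split_ifs <;> omega
  · ext w
    simp only [SimpleGraph.mem_neighborFinset, chordedCycle_adj, Finset.mem_insert,
      Finset.mem_singleton, Fin.ext_iff]
    split_ifs <;> omega

theorem chordedCycle_degree_of_le (hj : 2 ≤ j) (hn : 2 * j < n) {v : Fin n} (hv : 2 * j ≤ v.val) :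
    (chordedCycle n j).degree v = 2 := by
  rw [← SimpleGraph.card_neighborFinset_eq_degree, Finset.card_eq_two]
  refine ⟨⟨v.val - 1, by omega⟩, ⟨if v.val + 1 = n then 0 else v.val + 1, by split_ifs <;> omega⟩,
    ?_, ?_⟩
  · simp only [Ne, Fin.ext_iff]; split_ifs <;> omega
  · ext w
    simp only [SimpleGraph.mem_neighborFinset, chordedCycle_adj, Finset.mem_insert,
      Finset.mem_singleton, Fin.ext_iff]
    split_ifs <;> omega

theorem chordedCycle_card_edgeFinset (hj : 2 ≤ j) (hn : 2 * j < n) :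
    (chordedCycle n j).edgeFinset.card = n + j := by
  have h := (chordedCycle n j).sum_degrees_eq_twice_card_edges
  have hd : ∀ v : Fin n, (chordedCycle n j).degree v = 2 + if v.val < 2 * j then 1 else 0 := by
    intro v
    split_ifs with hv
    · rw [chordedCycle_degree_of_lt hj hn hv]
    · rw [chordedCycle_degree_of_le hj hn (not_lt.1 hv)]
  have hc : (Finset.univ.filter fun v : Fin n => v.val < 2 * j).card = 2 * j := by
    rw [Fin.card_filter_val_lt, min_eq_right hn.le]
  rw [Finset.sum_congr rfl fun v _ => hd v, Finset.sum_add_distrib, ← Finset.card_filter, hc] at h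
  simp at h
  omega

theorem chordedCycle_mDeg_le (hj : 2 ≤ j) (hn : 2 * j < n) :
    mDeg (chordedCycle n j) 2 3 ≤ 2 := by
  refine (Finset.card_le_card (t := {s(⟨2 * j - 1, by omega⟩, ⟨2 * j, hn⟩),
    s(⟨0, by omega⟩, ⟨n - 1, by omega⟩)}) ?_).trans Finset.card_le_two
  have key : ∀ u v : Fin n, (chordedCycle n j).Adj u v → (chordedCycle n j).degree u = 2 →
      (chordedCycle n j).degree v = 3 →
      (v.val = 2 * j - 1 ∧ u.val = 2 * j) ∨ (v.val = 0 ∧ u.val = n - 1) := by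
    intro u v huv hu hv
    have hu' : ¬ u.val < 2 * j := fun h => by
      have := chordedCycle_degree_of_lt hj hn h; omega
    have hv' : ¬ 2 * j ≤ v.val := fun h => by
      have := chordedCycle_degree_of_le hj hn h; omega
    rw [chordedCycle_adj] at huv
    omega
  intro e
  induction e using Sym2.ind with
  | _ u v =>
    intro he
    obtain ⟨he, hd⟩ := Finset.mem_filter.1 he
    have huv : (chordedCycle n j).Adj u v := SimpleGraph.mem_edgeFinset.1 he
    simp only [Finset.mem_insert, Finset.mem_singleton, Sym2.eq_iff, Fin.ext_iff]
    simp only [Sym2.lift_mk] at hd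
    rcases hd with ⟨hu, hv⟩ | ⟨hv, hu⟩
    · have := key u v huv hu hv; omega
    · have := key v u huv.symm hv hu; omega

theorem chordedCycle_bidegreed (hj : 2 ≤ j) (hn : 2 * j < n) (v : Fin n) :
    (chordedCycle n j).degree v = 2 ∨ (chordedCycle n j).degree v = 3 :=
  (le_or_gt (2 * j) v.val).imp (chordedCycle_degree_of_le hj hn) (chordedCycle_degree_of_lt hj hn)

end ChordedCycle

theorem minimal_pSombor_kcyclic (p : ℝ) (hp0 : 1 < p) (hp1 : p ≤ 2)
    (n k : ℕ) (hk : 3 ≤ k) (hn : 5 * (k - 1) ≤ n)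
    (G : SimpleGraph (Fin n)) (hconn : G.Connected) (hm : G.edgeFinset.card = n + k - 1)
    (hmin : ∀ H : SimpleGraph (Fin n), H.Connected → H.edgeFinset.card = n + k - 1 →
      pSomborIndex p G ≤ pSomborIndex p H) :
    (∀ v : Fin n, G.degree v = 2 ∨ G.degree v = 3) ∧
    (∃ v : Fin n, G.degree v = 2) ∧ (∃ v : Fin n, G.degree v = 3) ∧
    mDeg G 2 3 = 2 ∧ mDeg G 2 2 = n - 2 * k + 1 ∧ mDeg G 3 3 = 3 * k - 4 ∧
    pSomborIndex p G
      = 2 * ((2 : ℝ) ^ p + (3 : ℝ) ^ p) ^ (1 / p)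
        + ((n : ℝ) - 2 * k + 1) * ((2 : ℝ) ^ p + (2 : ℝ) ^ p) ^ (1 / p)
        + (3 * (k : ℝ) - 4) * ((3 : ℝ) ^ p + (3 : ℝ) ^ p) ^ (1 / p) := by
  obtain ⟨j, rfl⟩ : ∃ j, k = j + 1 := ⟨k - 1, by omega⟩
  have hj : 2 ≤ j := by omega
  have hjn : 2 * j < n := by omega
  have hm' : G.edgeFinset.card = n + j := by omega
  have hHb := chordedCycle_bidegreed hj hjn
  have hHc := chordedCycle_card_edgeFinset hj hjn
  have hH := hmin (chordedCycle n j) (chordedCycle_connected (by omega)) (by omega)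
  rw [pSomborIndex_of_bidegreed hp0 hHb, sum_degree_sq_of_bidegreed hHb, hHc,
    Fintype.card_fin] at hH
  have hc : (0 : ℝ) < 2 ^ (1 / p) := by positivity
  have hlt := pNorm_two_three_lt hp0
  have hgt := lt_pNorm hp0 (a := 2) (b := 3) (by norm_num) (by norm_num) (by norm_num)
  have h2 := pNorm_diag hp0 (a := 2) (by norm_num)
  have h3 := pNorm_diag hp0 (a := 3) (by norm_num)
  have hmH : (mDeg (chordedCycle n j) 2 3 : ℝ) ≤ 2 := by
    exact_mod_cast chordedCycle_mDeg_le hj hjn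
  have hb : ∀ v, G.degree v = 2 ∨ G.degree v = 3 := by
    by_contra hb
    have h1 := le_pSomborIndex G hp0
    have h4 := mul_le_mul_of_nonneg_left (le_sum_degree_sq_of_not_bidegreed hb)
      (by positivity : (0 : ℝ) ≤ 2 ^ (1 / p) / 2)
    rw [hm', Fintype.card_fin] at h4
    nlinarith
  have hS := pSomborIndex_of_bidegreed hp0 hb
  rw [sum_degree_sq_of_bidegreed hb, hm', Fintype.card_fin] at hS
  have hle : mDeg G 2 3 ≤ 2 := by
    have : (mDeg G 2 3 : ℝ) ≤ mDeg (chordedCycle n j) 2 3 := by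
      rw [hS] at hH
      exact le_of_mul_le_mul_right (add_le_add_iff_left _ |>.1 hH) (by linarith)
    exact_mod_cast this.trans hmH
  have hcard : (Finset.univ.filter fun v => G.degree v = 2).card
      + (Finset.univ.filter fun v => G.degree v = 3).card = n := by
    rw [Finset.card_filter, Finset.card_filter, ← Finset.sum_add_distrib,
      Finset.sum_congr rfl (g := fun _ => 1), Finset.sum_const]
    · simp
    · intro v _
      rcases hb v with hv | hv <;> simp [hv]
  have hsum : 2 * (Finset.univ.filter fun v => G.degree v = 2).card
      + 3 * (Finset.univ.filter fun v => G.degree v = 3).card = 2 * (n + j) := by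
    rw [← hm', ← G.sum_degrees_eq_twice_card_edges, Finset.card_filter, Finset.card_filter,
      Finset.mul_sum, Finset.mul_sum, ← Finset.sum_add_distrib]
    refine Finset.sum_congr rfl fun v _ => ?_
    rcases hb v with hv | hv <;> simp [hv]
  have hn2 := two_mul_card_degree_two hb
  have hn3 := three_mul_card_degree_three hb
  have he2 : ∃ v, G.degree v = 2 := by
    obtain ⟨v, hv⟩ := Finset.card_pos.1
      (by omega : 0 < (Finset.univ.filter fun v => G.degree v = 2).card)
    exact ⟨v, (Finset.mem_filter.1 hv).2⟩
  have he3 : ∃ v, G.degree v = 3 := by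
    obtain ⟨v, hv⟩ := Finset.card_pos.1
      (by omega : 0 < (Finset.univ.filter fun v => G.degree v = 3).card)
    exact ⟨v, (Finset.mem_filter.1 hv).2⟩
  have hpos := mDeg_two_three_pos hconn hb he2 he3
  have hm23 : mDeg G 2 3 = 2 := by omega
  refine ⟨hb, he2, he3, hm23, by omega, by omega, ?_⟩
  rw [hS, hm23, h2, h3]
  push_cast
  ring
end
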